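/- For every integer n ≥ 1, Σ_{P ∈ D_n} (−1)^{K(P)} = 2^{n−1}·s_{−1/2}(n); consequently, for every integer m ≥ 1 this sum equals 0 when n = 2m+1 and equals (−1)^m·c(m) when n = 2m. In particular, the number of Dyck paths in D_n with an even number of peaks and the number with an odd number of peaks are equal when n ≥ 3 is odd, and differ by the Catalan number c(n/2) in absolute value when n is even. -/

import Mathlib

open scoped Classical

/-- `s(n,k)`: `s(1,0) = 1`, `s(1,k) = 0` for `k ≥ 1`, and
`s(n,k) = (1/(n-1)) * C(n-1,k) * C(n+k-1,n)` for `n ≥ 2`. -/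
noncomputable def schroederS (n k : ℕ) : ℝ :=
  if n = 1 then (if k = 0 then 1 else 0)
  else (1 / ((n : ℝ) - 1)) * ((n - 1).choose k) * ((n + k - 1).choose n)

/-- Weighted small Schröder number `s_d(n) = Σ_{k=0}^{n-1} s(n,k) d^k`. -/
noncomputable def sd (d : ℝ) (n : ℕ) : ℝ :=
  ∑ k ∈ Finset.range n, schroederS n k * d ^ k


/-- A Dyck path of length `m`, encoded as `P : Fin m → Bool` with `true` = up step `U`
and `false` = down step `D`: equal numbers of up and down steps, and every prefix has
at least as many up steps as down steps. -/
def IsDyck {m : ℕ} (P : Fin m → Bool) : Prop :=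
  2 * (Finset.univ.filter fun i => P i = true).card = m ∧
  ∀ j : Fin m,
    (Finset.univ.filter fun i => i ≤ j ∧ P i = false).card ≤
      (Finset.univ.filter fun i => i ≤ j ∧ P i = true).card

/-- `V(P)`: number of valleys (a down step immediately followed by an up step). -/
noncomputable def valleys {m : ℕ} (P : Fin m → Bool) : ℕ :=
  (Finset.univ.filter fun i : Fin m =>
    (if h : (i : ℕ) + 1 < m then !(P i) && P ⟨(i : ℕ) + 1, h⟩ else false) = true).card

/-- `K(P)`: number of peaks (an up step immediately followed by a down step). -/
noncomputable def peaks {m : ℕ} (P : Fin m → Bool) : ℕ :=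
  (Finset.univ.filter fun i : Fin m =>
    (if h : (i : ℕ) + 1 < m then P i && !(P ⟨(i : ℕ) + 1, h⟩) else false) = true).card

/-- The signed-by-peaks sum over Dyck paths in `D_n`:
`Σ_{P ∈ D_n} (−1)^{K(P)}`. -/
noncomputable def peakSum (n : ℕ) : ℝ :=
  ∑ P ∈ Finset.univ.filter (fun P : Fin (2 * (n - 1)) → Bool => IsDyck P),
    (-1 : ℝ) ^ peaks P


open DyckStep in
/-- The number of peaks in a list of Dyck steps. -/
def listPeaks : List DyckStep → ℕ
  | [] => 0
  | a :: l => (if a = U ∧ l.head? = some D then 1 else 0) + listPeaks l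

open DyckStep in
lemma listPeaks_append (a b : List DyckStep) :
    listPeaks (a ++ b) =
      listPeaks a + (if a.getLast? = some U ∧ b.head? = some D then 1 else 0) + listPeaks b := by
  induction a with
  | nil => simp [listPeaks]
  | cons x l ih =>
    cases l with
    | nil => simp [listPeaks]
    | cons y l =>
      simp only [List.cons_append, listPeaks, List.head?_cons, List.getLast?_cons_cons] at ih ⊢
      rw [ih]
      simp only [add_assoc]
      congr

namespace DyckWord
open DyckStep

lemma head?_ne_D (p : DyckWord) : p.toList.head? ≠ some D := by
  by_cases h : p.toList = []
  · simp [h]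
  · simp [List.head?_eq_some_head h, p.head_eq_U h]

lemma getLast?_ne_U (p : DyckWord) : p.toList.getLast? ≠ some U := by
  by_cases h : p.toList = []
  · simp [h]
  · simp [List.getLast?_eq_some_getLast h, p.getLast_eq_D h]

lemma listPeaks_add (p q : DyckWord) :
    listPeaks (p + q).toList = listPeaks p.toList + listPeaks q.toList := by
  change listPeaks (p.toList ++ q.toList) = _
  simp [listPeaks_append, p.getLast?_ne_U]

lemma listPeaks_nest (p : DyckWord) :
    listPeaks p.nest.toList = if p = 0 then 1 else listPeaks p.toList := by
  change listPeaks ([U] ++ p.toList ++ [D]) = _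
  split_ifs with h
  · subst h
    change listPeaks [U, D] = 1
    simp [listPeaks]
  · have h' : p.toList ≠ [] := toList_ne_nil.2 h
    have h1 : ([U] ++ p.toList).getLast? = p.toList.getLast? := List.getLast?_append_of_ne_nil _ h'
    rw [listPeaks_append, h1, listPeaks_append]
    simp [p.head?_ne_D, p.getLast?_ne_U, listPeaks]

lemma ofTree_eq_zero_iff (t : BinaryTree Unit) : ofTree t = 0 ↔ t = .nil := by
  cases t with
  | nil => simp [ofTree]
  | node a l r =>
    simp only [ofTree, reduceCtorEq, iff_false]
    intro h
    have := congrArg semilength h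
    simp at this

end DyckWord

/-- The signed count, by number of peaks, of the Dyck words encoded by trees with `n` nodes. -/
noncomputable def treePeakSum (n : ℕ) : ℝ :=
  ∑ t ∈ BinaryTree.treesOfNumNodesEq n, (-1 : ℝ) ^ listPeaks (DyckWord.ofTree t).toList

lemma treePeakSum_zero : treePeakSum 0 = 1 := by
  simp only [treePeakSum, BinaryTree.treesOfNumNodesEq_zero, Finset.sum_singleton, DyckWord.ofTree]
  change (-1 : ℝ) ^ listPeaks [] = 1
  simp [listPeaks]

lemma sum_neg_one_pow_listPeaks_nest (i : ℕ) :
    ∑ t ∈ BinaryTree.treesOfNumNodesEq i,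
      (-1 : ℝ) ^ listPeaks (DyckWord.ofTree t).nest.toList =
        treePeakSum i - if i = 0 then 2 else 0 := by
  rcases Nat.eq_zero_or_pos i with rfl | hi
  · rw [treePeakSum_zero]
    simp [DyckWord.listPeaks_nest, DyckWord.ofTree_eq_zero_iff]
    norm_num
  · rw [if_neg hi.ne', sub_zero, treePeakSum]
    refine Finset.sum_congr rfl fun t ht => ?_
    rw [DyckWord.listPeaks_nest, if_neg]
    rw [DyckWord.ofTree_eq_zero_iff]
    rintro rfl
    rw [BinaryTree.mem_treesOfNumNodesEq] at ht
    exact hi.ne ht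

lemma treePeakSum_succ (n : ℕ) :
    treePeakSum (n + 1) = ∑ ij ∈ Finset.HasAntidiagonal.antidiagonal n,
      (treePeakSum ij.1 - if ij.1 = 0 then 2 else 0) * treePeakSum ij.2 := by
  rw [treePeakSum, BinaryTree.treesOfNumNodesEq_succ, Finset.sum_biUnion]
  · refine Finset.sum_congr rfl fun ij _ => ?_
    rw [Finset.sum_map, Finset.sum_product, ← sum_neg_one_pow_listPeaks_nest, treePeakSum,
      Finset.sum_mul_sum]
    refine Finset.sum_congr rfl fun l _ => Finset.sum_congr rfl fun r _ => ?_
    rw [← pow_add, ← DyckWord.listPeaks_add]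
    rfl
  · intro ij _ kl _ hne
    refine Finset.disjoint_left.2 fun t ht ht' => ?_
    simp only [Finset.mem_map, Finset.mem_product, BinaryTree.mem_treesOfNumNodesEq] at ht ht'
    obtain ⟨x, hx, rfl⟩ := ht
    obtain ⟨y, hy, hxy⟩ := ht'
    obtain ⟨-, h1, h2⟩ := BinaryTree.node.inj hxy
    exact hne (Prod.ext (by rw [← hx.1, ← hy.1, h1]) (by rw [← hx.2, ← hy.2, h2]))

open PowerSeries in
lemma treePeakSum_series :
    PowerSeries.mk treePeakSum = 1 + X * ((mk treePeakSum - 2) * mk treePeakSum) := by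
  ext n
  cases n with
  | zero => simp [treePeakSum_zero]
  | succ n =>
    have h2 : (2 : PowerSeries ℝ) = C (2 : ℝ) := (map_ofNat C 2).symm
    rw [map_add, coeff_succ_X_mul, coeff_mul, coeff_mk, treePeakSum_succ, h2]
    simp [coeff_C, coeff_one]

open PowerSeries in
lemma treePeakSum_series_eq :
    PowerSeries.mk treePeakSum = 1 - X * expand 2 two_ne_zero
      (rescale (-1 : ℝ) (catalanSeries.map (Nat.castRingHom ℝ))) := by
  set A := PowerSeries.mk treePeakSum with hA
  set G := expand 2 two_ne_zero
      (rescale (-1 : ℝ) (catalanSeries.map (Nat.castRingHom ℝ))) with hG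
  have hGe : G = 1 - X ^ 2 * G ^ 2 := by
    have := congrArg (fun f => expand 2 two_ne_zero
      (rescale (-1 : ℝ) (f.map (Nat.castRingHom ℝ)))) catalanSeries_sq_mul_X_add_one
    simp only [map_add, map_mul, map_pow, map_one, map_X, rescale_X, expand_X, expand_C, ← hG] at this
    rw [map_neg, map_one] at this
    linear_combination -this
  have hAe := treePeakSum_series
  rw [← hA] at hAe
  have hprod : (1 - A - X * G) * (1 + X * ((1 - A) + X * G)) = 0 := by
    linear_combination -hAe - X * hGe
  rcases mul_eq_zero.1 hprod with h | h
  · linear_combination -h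
  · have := congrArg constantCoeff h
    simp at this

lemma treePeakSum_odd (j : ℕ) : treePeakSum (2 * j + 1) = (-1) ^ (j + 1) * catalan j := by
  have := congrArg (PowerSeries.coeff (2 * j + 1)) treePeakSum_series_eq
  rw [PowerSeries.coeff_mk, map_sub, PowerSeries.coeff_succ_X_mul,
    PowerSeries.coeff_expand_mul] at this
  rw [this]
  simp [PowerSeries.coeff_one, PowerSeries.coeff_rescale]
  ring

lemma treePeakSum_even (j : ℕ) : treePeakSum (2 * j + 2) = 0 := by
  have := congrArg (PowerSeries.coeff (2 * j + 1 + 1)) treePeakSum_series_eq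
  rw [PowerSeries.coeff_mk, map_sub, PowerSeries.coeff_succ_X_mul,
    PowerSeries.coeff_expand_of_not_dvd _ _ _ (by omega)] at this
  rw [this]
  simp [PowerSeries.coeff_one]

open Polynomial in
lemma sum_choose_mul_choose_mul_pow (N : ℕ) :
    ∑ k ∈ Finset.range (N + 1),
      (N.choose k : ℝ) * ((N + k).choose (N + 1)) * ((-1) ^ k * 2 ^ (N - k)) =
      ((1 - X ^ 2 : ℝ[X]) ^ N).coeff (N + 1) := by
  have h : (1 - X ^ 2 : ℝ[X]) ^ N = ∑ k ∈ Finset.range (N + 1),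
      C ((N.choose k : ℝ) * ((-1) ^ k * 2 ^ (N - k))) * (1 + X) ^ (N + k) := by
    have : (1 - X ^ 2 : ℝ[X]) = (1 + X) * (-(1 + X) + 2) := by ring
    rw [this, mul_pow, add_pow (-(1 + X)), Finset.mul_sum]
    refine Finset.sum_congr rfl fun k _ => ?_
    simp only [map_mul, map_pow, map_neg, map_one, map_natCast, map_ofNat]
    rw [neg_pow (1 + X : ℝ[X])]
    ring
  rw [h, finsetSum_coeff]
  refine Finset.sum_congr rfl fun k _ => ?_
  rw [coeff_C_mul, coeff_one_add_X_pow]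
  ring

open Polynomial in
lemma coeff_one_sub_X_sq_pow (N k : ℕ) :
    ((1 - X ^ 2 : ℝ[X]) ^ N).coeff k =
      if 2 ∣ k then (N.choose (k / 2) : ℝ) * (-1) ^ (k / 2) else 0 := by
  have : (1 - X ^ 2 : ℝ[X]) ^ N = expand ℝ 2 (((1 + X) ^ N).comp (C (-1) * X)) := by
    simp
    ring
  rw [this, coeff_expand two_pos, comp_C_mul_X_coeff, coeff_one_add_X_pow]

lemma two_pow_mul_sd (N : ℕ) (hN : 1 ≤ N) :
    2 ^ N * sd (-1 / 2) (N + 1) = (1 / N) *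
      if 2 ∣ N + 1 then (N.choose ((N + 1) / 2) : ℝ) * (-1) ^ ((N + 1) / 2) else 0 := by
  rw [← coeff_one_sub_X_sq_pow, ← sum_choose_mul_choose_mul_pow, sd, Finset.mul_sum,
    Finset.mul_sum]
  refine Finset.sum_congr rfl fun k hk => ?_
  have hk' : k ≤ N := by simpa [Nat.lt_succ_iff] using hk
  obtain ⟨m, rfl⟩ := Nat.exists_eq_add_of_le hk'
  rw [schroederS, if_neg (by omega)]
  have h1 : k + m + 1 + k - 1 = k + m + k := by omega
  rw [h1, Nat.add_sub_cancel, Nat.add_sub_cancel_left, div_pow, pow_add]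
  push_cast
  field_simp
  ring

lemma two_pow_mul_sd_odd (j : ℕ) :
    2 ^ (2 * j + 1) * sd (-1 / 2) (2 * j + 2) = (-1) ^ (j + 1) * catalan j := by
  rw [two_pow_mul_sd _ (by omega), if_pos (by omega), show (2 * j + 1 + 1) / 2 = j + 1 by omega]
  have h1 := succ_mul_catalan_eq_centralBinom j
  have h2 := Nat.add_one_mul_choose_eq (2 * j) j
  rw [Nat.centralBinom] at h1
  have h3 : (2 * j + 1).choose (j + 1) = (2 * j + 1) * catalan j := by
    rw [← h1] at h2
    exact Nat.eq_of_mul_eq_mul_right (Nat.succ_pos j) (by rw [← h2, Nat.succ_eq_add_one]; ring)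
  rw [h3]
  push_cast
  field_simp

lemma two_pow_mul_sd_even (j : ℕ) : 2 ^ (2 * j + 2) * sd (-1 / 2) (2 * j + 3) = 0 := by
  rw [two_pow_mul_sd _ (by omega), if_neg (by omega), mul_zero]

lemma card_filter_lt_eq_count_take {α : Type*} [DecidableEq α] (a : α) (m : ℕ) (f : Fin m → α)
    (k : ℕ) :
    (Finset.univ.filter fun i : Fin m => (i : ℕ) < k ∧ f i = a).card =
      ((List.ofFn f).take k).count a := by
  induction m generalizing k with
  | zero => simp
  | succ m ih =>
    cases k with
    | zero => simp
    | succ k =>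
      rw [List.ofFn_succ, List.take_succ_cons, List.count_cons, ← ih (fun i => f i.succ) k,
        Finset.card_filter, Fin.sum_univ_succ, Finset.card_filter]
      simp [add_comm]

/-- The step of a Dyck word given by a Boolean, `true` being an up step. -/
def stepOfBool (b : Bool) : DyckStep := if b then .U else .D

lemma stepOfBool_eq_U {b : Bool} : stepOfBool b = .U ↔ b = true := by
  cases b <;> simp [stepOfBool]

lemma stepOfBool_eq_D {b : Bool} : stepOfBool b = .D ↔ b = false := by
  cases b <;> simp [stepOfBool]

/-- The list of steps of a path. -/
def stepList {m : ℕ} (P : Fin m → Bool) : List DyckStep := List.ofFn fun i => stepOfBool (P i)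

lemma length_stepList {m : ℕ} (P : Fin m → Bool) : (stepList P).length = m := by
  simp [stepList]

lemma stepList_injective {m : ℕ} : Function.Injective (stepList (m := m)) := by
  intro P Q h
  funext i
  have h' := congrFun (List.ofFn_injective h) i
  rw [Bool.eq_iff_iff, ← stepOfBool_eq_U, ← stepOfBool_eq_U]
  exact ⟨fun h => h'.symm.trans h, h'.trans⟩

lemma exists_stepList_eq (l : List DyckStep) : ∃ P : Fin l.length → Bool, stepList P = l := by
  refine ⟨fun i => l[i] = .U, ?_⟩
  refine List.ext_getElem (by simp [stepList]) fun i h₁ h₂ => ?_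
  rcases l[i].dichotomy with h | h <;> simp [stepList, stepOfBool, h]

lemma count_U_take_stepList {m : ℕ} (P : Fin m → Bool) (k : ℕ) :
    ((stepList P).take k).count .U =
      (Finset.univ.filter fun i : Fin m => (i : ℕ) < k ∧ P i = true).card := by
  rw [stepList, ← card_filter_lt_eq_count_take]
  simp only [stepOfBool_eq_U]

lemma count_D_take_stepList {m : ℕ} (P : Fin m → Bool) (k : ℕ) :
    ((stepList P).take k).count .D =
      (Finset.univ.filter fun i : Fin m => (i : ℕ) < k ∧ P i = false).card := by
  rw [stepList, ← card_filter_lt_eq_count_take]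
  simp only [stepOfBool_eq_D]

lemma count_U_add_count_D (l : List DyckStep) : l.count .U + l.count .D = l.length := by
  induction l with
  | nil => simp
  | cons a l ih => cases a <;> simp <;> omega

lemma isDyck_iff {m : ℕ} (P : Fin m → Bool) :
    IsDyck P ↔ (stepList P).count .U = (stepList P).count .D ∧
      ∀ k, ((stepList P).take k).count .D ≤ ((stepList P).take k).count .U := by
  have hlen := count_U_add_count_D (stepList P)
  have htot := count_U_take_stepList P m
  rw [List.take_of_length_le (length_stepList P).le] at htot
  rw [length_stepList] at hlen
  have hfil : (Finset.univ.filter fun i : Fin m => P i = true).card =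
      (stepList P).count .U := by
    rw [htot]
    simp
  have hle (j : Fin m) (b : Bool) :
      (Finset.univ.filter fun i => i ≤ j ∧ P i = b).card =
        (Finset.univ.filter fun i : Fin m => (i : ℕ) < j + 1 ∧ P i = b).card := by
    simp only [Nat.lt_succ_iff, Fin.le_def]
  have heq : 2 * (stepList P).count .U = m ↔ (stepList P).count .U = (stepList P).count .D := by
    omega
  rw [IsDyck, hfil, heq]
  refine and_congr_right fun hUD => ⟨fun h k => ?_, fun h j => ?_⟩
  · rcases k with _ | k
    · simp
    rcases lt_or_ge k m with hk | hk
    · have := h ⟨k, hk⟩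
      rwa [hle, hle, ← count_U_take_stepList, ← count_D_take_stepList] at this
    · rw [List.take_of_length_le (by rw [length_stepList]; omega), hUD]
  · rw [hle, hle, ← count_U_take_stepList, ← count_D_take_stepList]
    exact h _

lemma peaks_eq_listPeaks {m : ℕ} (P : Fin m → Bool) : peaks P = listPeaks (stepList P) := by
  induction m with
  | zero => simp [peaks, stepList, listPeaks]
  | succ m ih =>
    have h : stepList P = stepOfBool (P 0) :: stepList (fun i => P i.succ) := by
      simp [stepList, List.ofFn_succ]
    rw [h, listPeaks, ← ih, peaks, Finset.card_filter, Fin.sum_univ_succ, peaks,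
      Finset.card_filter]
    congr 1
    · cases m with
      | zero => simp [stepList]
      | succ m =>
        simp [stepList, List.ofFn_succ, stepOfBool_eq_U, stepOfBool_eq_D]
    · simp

lemma peakSum_eq_treePeakSum (N : ℕ) : peakSum (N + 1) = treePeakSum N := by
  rw [peakSum, treePeakSum]
  have hD (P : Fin (2 * N) → Bool)
      (hP : P ∈ Finset.univ.filter fun P : Fin (2 * N) → Bool => IsDyck P) :=
    (isDyck_iff P).1 (Finset.mem_filter.1 hP).2
  refine Finset.sum_bij (fun P hP => DyckWord.toTree ⟨stepList P, (hD P hP).1, (hD P hP).2⟩)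
    (fun P hP => ?_) (fun P hP Q hQ h => ?_) (fun t ht => ?_) (fun P hP => ?_)
  · rw [BinaryTree.mem_treesOfNumNodesEq, DyckWord.numNodes_toTree]
    have := DyckWord.two_mul_semilength_eq_length (p := ⟨stepList P, (hD P hP).1, (hD P hP).2⟩)
    simp only [length_stepList] at this
    omega
  · have := DyckWord.equivTree.injective h
    exact stepList_injective (congrArg DyckWord.toList this)
  · rw [BinaryTree.mem_treesOfNumNodesEq, ← DyckWord.toTree_ofTree t,
      DyckWord.numNodes_toTree] at ht
    have hlen := DyckWord.two_mul_semilength_eq_length (p := DyckWord.ofTree t)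
    rw [ht] at hlen
    obtain ⟨P, hP⟩ : ∃ P : Fin (2 * N) → Bool, stepList P = (DyckWord.ofTree t).toList :=
      hlen ▸ exists_stepList_eq _
    refine ⟨P, Finset.mem_filter.2 ⟨Finset.mem_univ _, (isDyck_iff P).2 ?_⟩, ?_⟩
    · rw [hP]
      exact ⟨(DyckWord.ofTree t).count_U_eq_count_D, (DyckWord.ofTree t).count_D_le_count_U⟩
    · exact (congrArg DyckWord.toTree (DyckWord.ext hP)).trans (DyckWord.toTree_ofTree t)
  · rw [DyckWord.ofTree_toTree, peaks_eq_listPeaks]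

lemma peakSum_odd (j : ℕ) : peakSum (2 * j + 3) = 0 := by
  rw [peakSum_eq_treePeakSum, treePeakSum_even]

lemma peakSum_even (j : ℕ) : peakSum (2 * j + 2) = (-1) ^ (j + 1) * catalan j := by
  rw [peakSum_eq_treePeakSum, treePeakSum_odd]

lemma peakSum_eq_card_sub_card (n : ℕ) :
    peakSum n =
      ((Finset.univ.filter fun P : Fin (2 * (n - 1)) → Bool => IsDyck P ∧ Even (peaks P)).card : ℝ)
        - (Finset.univ.filter fun P : Fin (2 * (n - 1)) → Bool =>
            IsDyck P ∧ Odd (peaks P)).card := by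
  rw [peakSum, ← Finset.sum_filter_add_sum_filter_not _ (fun P => Even (peaks P)),
    Finset.filter_filter, Finset.filter_filter, sub_eq_add_neg]
  simp only [Nat.not_even_iff_odd]
  congr 1
  · rw [Finset.sum_congr rfl (g := fun _ => 1)]
    · simp
    · intro P hP
      exact (Finset.mem_filter.1 hP).2.2.neg_one_pow
  · rw [Finset.sum_congr rfl (g := fun _ => -1)]
    · simp
    · intro P hP
      exact (Finset.mem_filter.1 hP).2.2.neg_one_pow

/-- `Σ_{P ∈ D_n} (−1)^{K(P)} = 2^{n−1}·s_{−1/2}(n)`; consequently it is `0` for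
`n = 2m+1` and `(−1)^m·c(m)` for `n = 2m` (`c(m) = catalan (m−1)`). In particular,
the numbers of Dyck paths in `D_n` with evenly and oddly many peaks are equal for odd
`n ≥ 3`, and differ by `c(n/2)` in absolute value for even `n`. -/
theorem peak_parity_sum :
    (∀ n : ℕ, 1 ≤ n → peakSum n = 2 ^ (n - 1) * sd (-1/2) n) ∧
    (∀ m : ℕ, 1 ≤ m →
      peakSum (2 * m + 1) = 0 ∧ peakSum (2 * m) = (-1 : ℝ) ^ m * (catalan (m - 1) : ℝ)) ∧
    (∀ n : ℕ, 3 ≤ n → Odd n →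
      (Finset.univ.filter fun P : Fin (2 * (n - 1)) → Bool =>
          IsDyck P ∧ Even (peaks P)).card
        = (Finset.univ.filter fun P : Fin (2 * (n - 1)) → Bool =>
            IsDyck P ∧ Odd (peaks P)).card) ∧
    (∀ n : ℕ, 1 ≤ n → Even n →
      (((Finset.univ.filter fun P : Fin (2 * (n - 1)) → Bool =>
          IsDyck P ∧ Even (peaks P)).card : ℤ)
        - ((Finset.univ.filter fun P : Fin (2 * (n - 1)) → Bool =>
            IsDyck P ∧ Odd (peaks P)).card : ℤ)).natAbs = catalan (n / 2 - 1)) := by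
  refine ⟨fun n hn => ?_, fun m hm => ?_, fun n hn hodd => ?_, fun n hn heven => ?_⟩
  · obtain ⟨N, rfl⟩ := Nat.exists_eq_add_of_le' hn
    obtain ⟨j, rfl | rfl⟩ := Nat.even_or_odd' N
    · cases j with
      | zero =>
        rw [peakSum_eq_treePeakSum, treePeakSum_zero]
        simp [sd, schroederS]
      | succ j => exact (peakSum_odd j).trans (two_pow_mul_sd_even j).symm
    · exact (peakSum_even j).trans (two_pow_mul_sd_odd j).symm
  · obtain ⟨j, rfl⟩ := Nat.exists_eq_add_of_le' hm
    exact ⟨peakSum_odd j, peakSum_even j⟩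
  · obtain ⟨j, rfl⟩ : ∃ j, n = 2 * j + 3 := by
      obtain ⟨k, rfl⟩ := hodd
      exact ⟨k - 1, by omega⟩
    have h := peakSum_eq_card_sub_card (2 * j + 3)
    rw [peakSum_odd] at h
    exact_mod_cast (sub_eq_zero.1 h.symm)
  · obtain ⟨j, rfl⟩ : ∃ j, n = 2 * j + 2 := by
      obtain ⟨k, rfl⟩ := heven
      exact ⟨k - 1, by omega⟩
    have h := peakSum_eq_card_sub_card (2 * j + 2)
    rw [peakSum_even] at h
    rw [show (2 * j + 2) / 2 - 1 = j by omega]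
    have h' : (((Finset.univ.filter fun P : Fin (2 * (2 * j + 2 - 1)) → Bool =>
          IsDyck P ∧ Even (peaks P)).card : ℤ)
        - ((Finset.univ.filter fun P : Fin (2 * (2 * j + 2 - 1)) → Bool =>
            IsDyck P ∧ Odd (peaks P)).card : ℤ)) = (-1) ^ (j + 1) * catalan j := by
      exact_mod_cast h.symm
    rw [h', Int.natAbs_mul, Int.natAbs_pow]
    simp
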